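/- Let p, q ∈ ℂ[z] be polynomials without multiple roots with 2 ≤ deg p ≤ deg q and deg q ≥ 3. Let F : Ve⁰(D_p) → Ve⁰(D_q) be an isomorphism of Lie algebras. Then there exists a ℂ-algebra isomorphism φ* : O(D_q) → O(D_p) such that F(δ) = (φ*)⁻¹ ∘ δ ∘ φ* for every δ ∈ Ve⁰(D_p). -/

import Mathlib

open Polynomial

set_option synthInstance.maxHeartbeats 400000
set_option maxHeartbeats 800000

noncomputable section

/-- The polynomial ring `ℂ[x,y,z]` (variables indexed by `Fin 3`). -/
abbrev P3 : Type := MvPolynomial (Fin 3) ℂ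

/-- The variable `x`. -/
def xP : P3 := MvPolynomial.X 0
/-- The variable `y`. -/
def yP : P3 := MvPolynomial.X 1
/-- The variable `z`. -/
def zP : P3 := MvPolynomial.X 2

/-- The ideal `(xy - p(z)) ⊆ ℂ[x,y,z]`. -/
def relIdeal (p : ℂ[X]) : Ideal P3 := Ideal.span {xP * yP - Polynomial.aeval zP p}

/-- The coordinate ring `O(D_p) = ℂ[x,y,z]/(xy - p(z))` of the Danielewski surface `D_p`. -/
abbrev ODan (p : ℂ[X]) : Type := P3 ⧸ relIdeal p

/-- A derivation is locally nilpotent if some power of it kills each element. -/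
def IsLND {p : ℂ[X]} (δ : Derivation ℂ (ODan p) (ODan p)) : Prop :=
  ∀ f : ODan p, ∃ n : ℕ, 1 ≤ n ∧ (δ.toLinearMap ^ n) f = 0

/-- The Lie subalgebra `⟨LND(D_p)⟩` of `Der_ℂ(O(D_p))` generated by all locally
nilpotent derivations. -/
def lndSpan (p : ℂ[X]) : LieSubalgebra ℂ (Derivation ℂ (ODan p) (ODan p)) :=
  LieSubalgebra.lieSpan ℂ _ {δ | IsLND δ}

/-- `Ve⁰(D_p)`: the divergence-zero vector fields on `D_p`, i.e. those derivations of
`O(D_p)` admitting a lift `δ' = ã∂/∂x + b̃∂/∂y + c̃∂/∂z ∈ Der_ℂ(ℂ[x,y,z])` with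
`δ'(xy - p(z)) = 0` and `∂ã/∂x + ∂b̃/∂y + ∂c̃/∂z ∈ (xy - p(z))`. -/
def VeZero (p : ℂ[X]) : Set (Derivation ℂ (ODan p) (ODan p)) :=
  {δ | ∃ δ' : Derivation ℂ P3 P3,
    δ' (xP * yP - Polynomial.aeval zP p) = 0 ∧
    (∀ f : P3, δ (Ideal.Quotient.mk (relIdeal p) f) = Ideal.Quotient.mk (relIdeal p) (δ' f)) ∧
    MvPolynomial.pderiv (0 : Fin 3) (δ' xP) + MvPolynomial.pderiv (1 : Fin 3) (δ' yP) +
      MvPolynomial.pderiv (2 : Fin 3) (δ' zP) ∈ relIdeal p}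

/-- The structure on `A` and a Lie algebra `V` of derivations used in the argument. -/
structure PoisD (A : Type) [CommRing A] [Algebra ℂ A]
    (V : LieSubalgebra ℂ (Derivation ℂ A A)) where
  br : A →ₗ[ℂ] Derivation ℂ A A
  alt : ∀ f g, br f g = - br g f
  mem : ∀ f, br f ∈ V
  poi : ∀ D ∈ V, ∀ f g, D (br f g) = br (D f) g + br f (D g)
  pl : ∀ (D : Derivation ℂ A A) (f g k : A), D f * br g k + D g * br k f + D k * br f g = 0
  uni : Ideal.span {t : A | ∃ f g, t = br f g} = ⊤
  nd2 : ∀ χ : A →ₐ[ℂ] ℂ, ∃ a b c d f, χ (br (br (br a b) (br c d)) f) ≠ 0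
  pts : ∀ a : A, (∀ χ : A →ₐ[ℂ] ℂ, χ a = 0) → a = 0
  maxpt : ∀ J : Ideal A, J ≠ ⊤ → ∃ χ : A →ₐ[ℂ] ℂ, ∀ a ∈ J, χ a = 0
  cen : ∀ e : A, (∀ g, br g e = 0) → ∃ l : ℂ, e = algebraMap ℂ A l
  cover : ∀ χ : A →ₐ[ℂ] ℂ, ∃ h k, br k h = h ∧ χ h ≠ 0
  gen : Algebra.adjoin ℂ {t : A | ∃ f g, t = br f g} = ⊤

namespace PoisD

section one
variable {A : Type} [CommRing A] [Algebra ℂ A] {V : LieSubalgebra ℂ (Derivation ℂ A A)}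
  (P : PoisD A V)

/-- Hamiltonian vector field as an element of `V`. -/
def ham : A →ₗ[ℂ] V where
  toFun f := ⟨P.br f, P.mem f⟩
  map_add' f g := by ext; simp
  map_smul' c g := by ext; simp

theorem ham_apply (f g : A) : (P.ham f : Derivation ℂ A A) g = P.br f g := rfl

theorem br_mul_left (f g h : A) : P.br (f * g) h = f * P.br g h + g * P.br f h := by
  rw [P.alt (f * g) h, P.alt f h, P.alt g h, Derivation.leibniz]
  simp only [smul_eq_mul]; ring

theorem cancel {a : A} (h : ∀ f g, a * P.br f g = 0) : a = 0 := by
  have h1 : (1 : A) ∈ Ideal.span {t : A | ∃ f g, t = P.br f g} := by rw [P.uni]; trivial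
  have : ∀ t ∈ Ideal.span {t : A | ∃ f g, t = P.br f g}, a * t = 0 := by
    intro t ht
    induction ht using Submodule.span_induction with
    | mem x hx => obtain ⟨f, g, rfl⟩ := hx; exact h f g
    | zero => simp
    | add x y _ _ hx hy => rw [mul_add, hx, hy, add_zero]
    | smul c x _ hx => rw [smul_eq_mul, mul_left_comm, hx, mul_zero]
  simpa using this 1 h1

theorem nd (χ : A →ₐ[ℂ] ℂ) : ∃ f g, χ (P.br f g) ≠ 0 := by
  by_contra hcon
  push Not at hcon
  have h1 : (1 : A) ∈ Ideal.span {t : A | ∃ f g, t = P.br f g} := by rw [P.uni]; trivial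
  have : Ideal.span {t : A | ∃ f g, t = P.br f g} ≤ RingHom.ker χ := by
    rw [Ideal.span_le]
    rintro _ ⟨f, g, rfl⟩
    exact hcon f g
  have := this h1
  simp [RingHom.mem_ker] at this

theorem exists_om (D E : V) : ∃ h : A, ∀ f g,
    D.1 f * E.1 g - D.1 g * E.1 f = h * P.br f g := by
  have h1 : (1 : A) ∈ Ideal.span {t : A | ∃ f g, t = P.br f g} := by rw [P.uni]; trivial
  have : ∀ t ∈ Ideal.span {t : A | ∃ f g, t = P.br f g}, ∃ h : A, ∀ f g,
      t * (D.1 f * E.1 g - D.1 g * E.1 f) = h * P.br f g := by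
    intro t ht
    induction ht using Submodule.span_induction with
    | mem x hx =>
      obtain ⟨f', g', rfl⟩ := hx
      refine ⟨D.1 f' * E.1 g' - D.1 g' * E.1 f', fun f g => ?_⟩
      have e1 := P.pl E.1 f' g' g
      have e2 := P.pl E.1 f' g' f
      have e3 := P.pl D.1 f g g'
      have e4 := P.pl D.1 f g f'
      have a1 := P.alt g g'
      have a3 := P.alt f f'
      linear_combination D.1 f * e1 - D.1 g * e2 + E.1 f' * e3 - E.1 g' * e4
        - D.1 f * E.1 f' * a1 + D.1 g * E.1 g' * a3
    | zero => exact ⟨0, by simp⟩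
    | add x y _ _ hx hy =>
      obtain ⟨h, hh⟩ := hx
      obtain ⟨k, hk⟩ := hy
      exact ⟨h + k, fun f g => by linear_combination hh f g + hk f g⟩
    | smul c x _ hx =>
      obtain ⟨h, hh⟩ := hx
      exact ⟨c * h, fun f g => by rw [smul_eq_mul]; linear_combination c * hh f g⟩
  simpa using this 1 h1

/-- The symplectic form. -/
def om (D E : V) : A := (P.exists_om D E).choose

theorem om_spec (D E : V) (f g : A) :
    D.1 f * E.1 g - D.1 g * E.1 f = P.om D E * P.br f g := (P.exists_om D E).choose_spec f g

theorem om_ham (D : V) (h : A) : P.om D (P.ham h) = D.1 h := by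
  rw [← sub_eq_zero]
  apply P.cancel
  intro f g
  rw [sub_mul, ← P.om_spec, ham_apply, ham_apply]
  have := P.pl D.1 f g h
  have a1 := P.alt h g
  rw [a1]
  linear_combination - this

theorem lie_eq (D E : V) : ⁅D, E⁆ = P.ham (P.om D E) := by
  ext k
  rw [ham_apply, LieSubalgebra.coe_bracket, ← sub_eq_zero]
  apply P.cancel
  intro f g
  have hk := P.om_spec D E (P.br f g) k
  have hf := congrArg (fun t => P.br t k) (P.om_spec D E f g)
  simp only [map_sub, P.br_mul_left, Derivation.sub_apply] at hf
  rw [P.poi D.1 D.2, P.poi E.1 E.2] at hk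
  have p1 := P.pl E.1 (D.1 f) g k
  have p2 := P.pl E.1 f (D.1 g) k
  have p3 := P.pl D.1 f (E.1 g) k
  have p4 := P.pl D.1 (E.1 f) g k
  have p5 := P.pl ⁅D.1, E.1⁆ f g k
  simp only [Derivation.commutator_apply] at p5 ⊢
  have a1 := P.alt k (D.1 f)
  have a2 := P.alt k (E.1 f)
  have a3 := P.alt k (D.1 g)
  have a4 := P.alt k (E.1 g)
  have a5 := P.alt k f
  rw [a1] at p1
  rw [a2] at p4
  rw [a5] at *
  linear_combination p5 + p1 + p2 - p3 - p4 + hf - hk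

/-- isotropy subspace condition -/
def Iso (χ : A →ₐ[ℂ] ℂ) (D : V) : Prop := ∀ f, χ (D.1 f) = 0

theorem iso_of {χ : A →ₐ[ℂ] ℂ} {D : V} {f g : A} (h : χ (P.br f g) ≠ 0)
    (hf : χ (D.1 f) = 0) (hg : χ (D.1 g) = 0) : Iso χ D := by
  intro k
  have := congrArg χ (P.pl D.1 f g k)
  simp only [map_add, map_mul, map_zero, hf, hg, zero_mul, zero_add] at this
  exact (mul_eq_zero.1 this).resolve_right h

theorem iso_lie {χ : A →ₐ[ℂ] ℂ} {D E : V} (hD : Iso χ D) (hE : Iso χ E) :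
    Iso χ ⁅D, E⁆ := by
  intro f
  have : ∀ D : V, Iso χ D → ∀ f, χ (D.1 f) = 0 := fun D hD f => hD f
  rw [LieSubalgebra.coe_bracket, Derivation.commutator_apply, map_sub, this _ hD, this _ hE,
    sub_zero]

theorem om_iso_left {χ : A →ₐ[ℂ] ℂ} {D E : V} (hD : Iso χ D) : χ (P.om D E) = 0 := by
  obtain ⟨f, g, h⟩ := P.nd χ
  have := congrArg χ (P.om_spec D E f g)
  simp only [map_sub, map_mul, hD f, hD g, zero_mul, sub_zero] at this
  exact (mul_eq_zero.1 this.symm).resolve_right h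

theorem om_val {χ : A →ₐ[ℂ] ℂ} {f g : A} (D E : V) :
    χ (P.om D E) * χ (P.br f g) = χ (D.1 f) * χ (E.1 g) - χ (D.1 g) * χ (E.1 f) := by
  have := congrArg χ (P.om_spec D E f g)
  simpa using this.symm

theorem iso_sep (P : PoisD A V) {χ χ' : A →ₐ[ℂ] ℂ} (h : ∀ D : V, Iso χ D → Iso χ' D) : χ = χ' := by
  ext b
  by_contra hne
  set a := b - algebraMap ℂ A (χ b) with ha
  have h1 : χ a = 0 := by simp [ha]
  have h2 : χ' a ≠ 0 := by
    simp only [ha, map_sub, AlgHom.commutes]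
    intro h3
    exact hne (sub_eq_zero.1 h3).symm
  obtain ⟨f, g', hfg⟩ := P.nd χ'
  set g := f - algebraMap ℂ A (χ' f) with hg
  have hg0 : χ' g = 0 := by simp [hg]
  have hgf : χ' (P.br g g') ≠ 0 := by
    have : P.br g g' = P.br f g' := by
      rw [P.alt, P.alt f, hg, map_sub]; simp
    rwa [this]
  have i1 : Iso χ (P.ham (a * a * g)) := by
    intro k
    rw [ham_apply, P.br_mul_left, P.br_mul_left]
    simp [h1]
  have := h _ i1 g'
  rw [ham_apply, P.br_mul_left, P.br_mul_left] at this
  simp only [map_add, map_mul, hg0, zero_mul, add_zero, mul_eq_zero] at this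
  tauto

end one

theorem cofin {A : Type} [CommRing A] [Algebra ℂ A] (S C : Submodule ℂ A)
    [Module.Finite ℂ (A ⧸ S)] (m : A →ₗ[ℂ] A →ₗ[ℂ] A)
    (hm : ∀ a ∈ S, ∀ b ∈ S, m a b ∈ S) (hC : ∀ a, (∀ b, m a b ∈ S) → a ∈ C) :
    Module.Finite ℂ (A ⧸ C) := by
  obtain ⟨r, s, hs⟩ := Module.Finite.exists_fin (R := ℂ) (M := A ⧸ S)
  choose g hg using fun i => S.mkQ_surjective (s i)
  let T : A →ₗ[ℂ] (A ⧸ S) × (Fin r → A ⧸ S) :=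
    S.mkQ.prod (LinearMap.pi fun i => S.mkQ ∘ₗ m.flip (g i))
  have hT : LinearMap.ker T ≤ C := by
    intro a ha
    have ha' : S.mkQ a = 0 ∧ ∀ i, S.mkQ (m a (g i)) = 0 := by
      have h := LinearMap.mem_ker.1 ha
      exact ⟨congrArg Prod.fst h, fun i => congrFun (congrArg Prod.snd h) i⟩
    simp only [Submodule.mkQ_apply, Submodule.Quotient.mk_eq_zero] at ha'
    apply hC
    intro b
    have hb : S.mkQ b ∈ Submodule.span ℂ (Set.range s) := by rw [hs]; trivial
    have key : Submodule.span ℂ (Set.range s) ≤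
        Submodule.map S.mkQ (Submodule.comap (m a) S) := by
      rw [Submodule.span_le]
      rintro _ ⟨i, rfl⟩
      exact ⟨g i, ha'.2 i, hg i⟩
    obtain ⟨b', hb', hbb⟩ := key hb
    have h3 : b - b' ∈ S := by
      rw [← Submodule.Quotient.mk_eq_zero, ← Submodule.mkQ_apply, map_sub, hbb, sub_self]
    have h4 := S.add_mem (hm a ha'.1 _ h3) hb'
    simpa using h4
  have f1 : Module.Finite ℂ (A ⧸ LinearMap.ker T) :=
    Module.Finite.equiv T.quotKerEquivRange.symm
  exact Module.Finite.of_surjective (Submodule.factor hT) (Submodule.factor_surjective hT)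

section two
variable {A B : Type} [CommRing A] [Algebra ℂ A] {V : LieSubalgebra ℂ (Derivation ℂ A A)}
  [CommRing B] [Algebra ℂ B] {W : LieSubalgebra ℂ (Derivation ℂ B B)}

theorem stab {A : Type} [CommRing A] [Algebra ℂ A] (J : Ideal A)
    (hfin : Module.Finite ℂ (A ⧸ J.restrictScalars ℂ)) (χ : A →ₐ[ℂ] ℂ) (hχ : ∀ a ∈ J, χ a = 0)
    (D : Derivation ℂ A A) (hD : ∀ a ∈ J, D a ∈ J) (a : A) (ha : χ a = 0) : χ (D a) = 0 := by
  classical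
  have hfin' : Module.Finite ℂ (A ⧸ J) := hfin
  have hex : ∃ k : ℕ, ∃ b, χ b ≠ 0 ∧ b * a ^ k ∈ J := by
    obtain ⟨u, hu, hu0⟩ := Algebra.IsIntegral.isIntegral (R := ℂ) (Ideal.Quotient.mk J a)
    obtain ⟨v, hv, hv0⟩ := Polynomial.exists_eq_pow_rootMultiplicity_mul_and_not_dvd u hu.ne_zero 0
    refine ⟨u.rootMultiplicity 0, Polynomial.aeval a v, ?_, ?_⟩
    · have : χ (Polynomial.aeval a v) = v.eval 0 := by
        rw [← Polynomial.aeval_algHom_apply, ha, Polynomial.coe_aeval_eq_eval]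
      rw [this]
      intro h
      exact hv0 (Polynomial.dvd_iff_isRoot.2 h)
    · rw [← Ideal.Quotient.eq_zero_iff_mem]
      have h1 : Ideal.Quotient.mk J (Polynomial.aeval a u) = 0 := by
        have := Polynomial.aeval_algHom_apply (Ideal.Quotient.mkₐ ℂ J) a u
        rw [Ideal.Quotient.mkₐ_eq_mk] at this
        rw [← this]
        exact hu0
      rw [← h1]
      congr 1
      conv_rhs => rw [hv]
      simp [mul_comm]
  by_contra hne
  obtain ⟨b, hb, hJ⟩ := Nat.find_spec hex
  have hmin := fun m (hm : m < Nat.find hex) => Nat.find_min hex hm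
  generalize Nat.find hex = k at hJ hmin
  cases k with
  | zero => exact hb (by simpa using hχ _ hJ)
  | succ k =>
    refine hmin k (Nat.lt_succ_self k) ⟨algebraMap ℂ A (k + 1) * (b ^ 2 * D a), ?_, ?_⟩
    · simp only [map_mul, map_pow, AlgHom.commutes]
      have : ((k : ℂ) + 1) ≠ 0 := by exact_mod_cast Nat.succ_ne_zero k
      simpa using ⟨this, hb, hne⟩
    · have h1 := hD _ hJ
      have h2 : algebraMap ℂ A (k + 1) * (b ^ 2 * D a) * a ^ k
          = b * D (b * a ^ (k + 1)) - D b * (b * a ^ (k + 1)) := by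
        rw [Derivation.leibniz, Derivation.leibniz_pow]
        simp only [smul_eq_mul, nsmul_eq_mul, map_add, map_natCast, map_one, Nat.add_sub_cancel]
        push_cast
        ring
      rw [h2]
      exact J.sub_mem (J.mul_mem_left _ h1) (J.mul_mem_left _ hJ)

theorem exists_pt (P : PoisD A V) (Q : PoisD B W) (F : V ≃ₗ⁅ℂ⁆ W) (n : B →ₐ[ℂ] ℂ) :
    ∃ χ : A →ₐ[ℂ] ℂ, ∀ D : V, Iso n (F D) → Iso χ D := by
  obtain ⟨f0, g0, h0⟩ := Q.nd n
  let ev : B → (A →ₗ[ℂ] ℂ) := fun u =>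
    { toFun := fun f => n ((F (P.ham f)).1 u)
      map_add' := by intro a b; simp
      map_smul' := by intro a b; simp }
  let T : A →ₗ[ℂ] ℂ × ℂ := (ev f0).prod (ev g0)
  let S := LinearMap.ker T
  have hS : ∀ f, f ∈ S ↔ Iso n (F (P.ham f)) := by
    intro f
    constructor
    · intro h
      have h := LinearMap.mem_ker.1 h
      exact Q.iso_of h0 (congrArg Prod.fst h) (congrArg Prod.snd h)
    · intro h
      exact LinearMap.mem_ker.2 (Prod.ext (h f0) (h g0))
  have fS : Module.Finite ℂ (A ⧸ S) := Module.Finite.equiv T.quotKerEquivRange.symm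
  have hamlie : ∀ (D : V) f, ⁅D, P.ham f⁆ = P.ham (D.1 f) := by
    intro D f
    rw [P.lie_eq, P.om_ham]
  have Slie : ∀ D : V, Iso n (F D) → ∀ f ∈ S, D.1 f ∈ S := by
    intro D hD f hf
    rw [hS] at *
    rw [← hamlie, LieEquiv.map_lie]
    exact iso_lie hD hf
  let N : Submodule ℂ A :=
    { carrier := {f | ∀ g, P.br f g ∈ S}
      add_mem' := by
        intro a b ha hb g
        rw [map_add, Derivation.add_apply]
        exact S.add_mem (ha g) (hb g)
      zero_mem' := by intro g; simp
      smul_mem' := by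
        intro c a ha g
        rw [map_smul, Derivation.smul_apply]
        exact S.smul_mem c (ha g) }
  have hN : ∀ f, f ∈ N ↔ ∀ g, P.br f g ∈ S := fun f => Iff.rfl
  have Nmul : ∀ f ∈ N, ∀ g ∈ N, f * g ∈ N := by
    intro f hf g hg k
    have e : P.br (f * g) k = P.br f (g * k) + P.br g (f * k) := by
      rw [P.br_mul_left, Derivation.leibniz, Derivation.leibniz, P.alt g f]
      simp only [smul_eq_mul]; ring
    rw [e]
    exact S.add_mem (hf _) (hg _)
  have fN : Module.Finite ℂ (A ⧸ N) :=
    cofin S N (LinearMap.mk₂ ℂ (fun f g => P.br f g) (by simp) (by simp) (by simp) (by simp))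
      (by
        intro a ha b hb
        exact Slie (P.ham a) ((hS a).1 ha) b hb)
      (fun a ha => ha)
  let J : Ideal A :=
    { carrier := {a | ∀ b, a * b ∈ N}
      add_mem' := by
        intro a b ha hb g
        rw [add_mul]
        exact N.add_mem (ha g) (hb g)
      zero_mem' := by intro g; simp
      smul_mem' := by
        intro c a ha g
        rw [smul_eq_mul, mul_comm c, mul_assoc]
        exact ha _ }
  have fJ : Module.Finite ℂ (A ⧸ J.restrictScalars ℂ) :=
    cofin N (J.restrictScalars ℂ) (LinearMap.mul ℂ A)
      (by
        intro a ha b hb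
        exact Nmul a ha b hb)
      (fun a ha => ha)
  have hJ : J ≠ ⊤ := by
    intro h
    have h1 : ∀ f, f ∈ N := by
      intro f
      have : (1 : A) ∈ J := by rw [h]; trivial
      simpa using this f
    obtain ⟨a, b, c, d, f, hf⟩ := Q.nd2 n
    apply hf
    have key : ∀ D E : W, ∃ h : A, ⁅D, E⁆ = F (P.ham h) := by
      intro D E
      refine ⟨P.om (F.symm D) (F.symm E), ?_⟩
      rw [← P.lie_eq, LieEquiv.map_lie, LieEquiv.apply_symm_apply, LieEquiv.apply_symm_apply]
    have hb : ∀ a b : B, Q.ham (Q.br a b) = ⁅Q.ham a, Q.ham b⁆ := by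
      intro a b
      rw [Q.lie_eq, Q.om_ham, ham_apply]
    obtain ⟨h, hh⟩ := key (Q.ham a) (Q.ham b)
    obtain ⟨k, hk⟩ := key (Q.ham c) (Q.ham d)
    have e : Q.ham (Q.br (Q.br a b) (Q.br c d)) = F (P.ham (P.br h k)) := by
      rw [hb, hb, hb, hh, hk, ← LieEquiv.map_lie, P.lie_eq, P.om_ham, ham_apply]
    have := (hS _).1 (h1 h k) f
    rw [← e, ham_apply] at this
    exact this
  obtain ⟨χ, hχ⟩ := P.maxpt J hJ
  refine ⟨χ, fun D hD f => ?_⟩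
  have hstab : ∀ a ∈ J, D.1 a ∈ J := by
    have NN : ∀ a ∈ N, D.1 a ∈ N := by
      intro a ha g
      have e : P.br (D.1 a) g = D.1 (P.br a g) - P.br a (D.1 g) := by
        rw [P.poi D.1 D.2]; ring
      rw [e]
      exact S.sub_mem (Slie D hD _ (ha g)) (ha _)
    intro a ha b
    have e : D.1 a * b = D.1 (a * b) - a * D.1 b := by
      rw [Derivation.leibniz]; simp only [smul_eq_mul]; ring
    rw [e]
    exact N.sub_mem (NN _ (ha b)) (ha _)
  have h1 : χ (f - algebraMap ℂ A (χ f)) = 0 := by simp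
  have := stab J fJ χ hχ D.1 hstab _ h1
  simpa using this

end two

section three
variable {A B : Type} [CommRing A] [Algebra ℂ A] {V : LieSubalgebra ℂ (Derivation ℂ A A)}
  [CommRing B] [Algebra ℂ B] {W : LieSubalgebra ℂ (Derivation ℂ B B)}

theorem br_self (P : PoisD A V) (f : A) : P.br f f = 0 := by
  have h := P.alt f f
  have h2 : (2 : ℂ) • P.br f f = 0 := by rw [two_smul]; linear_combination h
  simpa using h2

theorem exists_c (P : PoisD A V) (Q : PoisD B W) (F : V ≃ₗ⁅ℂ⁆ W) (n : B →ₐ[ℂ] ℂ)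
    (χ : A →ₐ[ℂ] ℂ) (hφ : ∀ D : V, Iso χ D → Iso n (F D)) :
    ∃ c : ℂ, c ≠ 0 ∧ ∀ D E : V, n (Q.om (F D) (F E)) = c * χ (P.om D E) := by
  obtain ⟨f, g, ht⟩ := P.nd χ
  obtain ⟨f1, g1, hs⟩ := Q.nd n
  set t := χ (P.br f g) with htdef
  set s := n (Q.br f1 g1) with hsdef
  have hff : χ (P.br f f) = 0 := by rw [P.br_self]; simp
  have hgg : χ (P.br g g) = 0 := by rw [P.br_self]; simp
  have hgf : χ (P.br g f) = -t := by rw [P.alt]; simp [htdef]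
  have dec : ∀ (D : V) (k : B), n ((F D).1 k) = χ (D.1 g) / t * n ((F (P.ham f)).1 k)
      - χ (D.1 f) / t * n ((F (P.ham g)).1 k) := by
    intro D k
    have h1 : Iso χ (D - (χ (D.1 g) / t) • P.ham f + (χ (D.1 f) / t) • P.ham g) := by
      apply P.iso_of (f := f) (g := g) ht
      · simp [ham_apply, hff, hgf]
        field_simp
        ring
      · simp [ham_apply, hgg, ← htdef]
        field_simp
        ring
    have h2 := hφ _ h1 k
    simp at h2
    linear_combination h2
  have key : ∀ D E : V, n (Q.om (F D) (F E)) =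
      n (Q.om (F (P.ham f)) (F (P.ham g))) / t * χ (P.om D E) := by
    intro D E
    have e1 := Q.om_val (χ := n) (f := f1) (g := g1) (F D) (F E)
    have e2 := Q.om_val (χ := n) (f := f1) (g := g1) (F (P.ham f)) (F (P.ham g))
    have e3 := P.om_val (χ := χ) (f := f) (g := g) D E
    rw [dec D, dec D, dec E, dec E] at e1
    have e3' : χ (P.om D E) = (χ (D.1 f) * χ (E.1 g) - χ (D.1 g) * χ (E.1 f)) / t := by
      field_simp; exact e3
    rw [e3']
    apply mul_right_cancel₀ hs
    rw [e1]
    have : n (Q.om (F (P.ham f)) (F (P.ham g))) / t * ((χ (D.1 f) * χ (E.1 g) - χ (D.1 g) * χ (E.1 f)) / t) * s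
      = (n (Q.om (F (P.ham f)) (F (P.ham g))) * s) * ((χ (D.1 f) * χ (E.1 g) - χ (D.1 g) * χ (E.1 f)) / t / t) := by ring
    rw [this, e2]
    field_simp
    ring
  refine ⟨_, ?_, key⟩
  intro h0
  have := key (F.symm (Q.ham f1)) (F.symm (Q.ham g1))
  rw [h0, zero_mul, LieEquiv.apply_symm_apply, LieEquiv.apply_symm_apply, Q.om_ham,
    ham_apply] at this
  exact hs this

theorem half (P : PoisD A V) (Q : PoisD B W) (F : V ≃ₗ⁅ℂ⁆ W)
    (φ : (B →ₐ[ℂ] ℂ) → (A →ₐ[ℂ] ℂ)) (hφ : ∀ n (D : V), Iso (φ n) D → Iso n (F D)) :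
    ∃ ψ : A →ₐ[ℂ] B, (∀ n h, n (ψ h) = φ n h) ∧ ∀ (D : V) h, (F D).1 (ψ h) = ψ (D.1 h) := by
  choose c hc0 hc using fun n => exists_c P Q F n (φ n) (hφ n)
  have ptsB : ∀ u v : B, (∀ n : B →ₐ[ℂ] ℂ, n u = n v) → u = v := by
    intro u v h
    rw [← sub_eq_zero]
    apply Q.pts
    intro n
    rw [map_sub, h, sub_self]
  -- pairs
  let u : A → A → B := fun a b => Q.om (F (P.ham a)) (F (P.ham b))
  have hu : ∀ a b n, n (u a b) = c n * φ n (P.br a b) := by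
    intro a b n
    rw [hc, P.om_ham, ham_apply]
  have hu2 : ∀ a b, F (P.ham (P.br a b)) = Q.ham (u a b) := by
    intro a b
    rw [← Q.lie_eq, ← LieEquiv.map_lie, P.lie_eq, P.om_ham, ham_apply]
  have hu3 : ∀ (D : V) a b n, n ((F D).1 (u a b)) = c n * φ n (D.1 (P.br a b)) := by
    intro D a b n
    rw [← Q.om_ham, ← hu2, hc, P.om_ham]
  -- the function 1 / c
  have hI : ∃ e : B, ∀ n, n e * c n = 1 := by
    let I : Ideal B :=
      { carrier := {t | ∃ e : B, ∀ n : B →ₐ[ℂ] ℂ, n e * c n = n t}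
        add_mem' := by
          rintro a b ⟨e, he⟩ ⟨e', he'⟩
          exact ⟨e + e', fun n => by rw [map_add, map_add, add_mul, he, he']⟩
        zero_mem' := ⟨0, by simp⟩
        smul_mem' := by
          rintro s a ⟨e, he⟩
          exact ⟨s * e, fun n => by rw [smul_eq_mul, map_mul, map_mul, mul_assoc, he]⟩ }
    have hIt : I = ⊤ := by
      by_contra hne
      obtain ⟨n, hn⟩ := Q.maxpt I hne
      obtain ⟨h, k, hkh, hh⟩ := P.cover (φ n)
      have : u k h ^ 2 ∈ I := by
        refine ⟨algebraMap ℂ B (1 / 2) * u k (h * h), fun n => ?_⟩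
        rw [map_mul, map_pow, hu, hu, Derivation.leibniz, hkh, AlgHom.commutes]
        simp only [smul_eq_mul, map_add, map_mul, Algebra.algebraMap_self, RingHom.id_apply]
        ring
      have := hn _ this
      rw [map_pow, hu, hkh] at this
      have := pow_eq_zero_iff (two_ne_zero) |>.1 this
      exact (mul_ne_zero (hc0 n) hh) this
    have : (1 : B) ∈ I := by rw [hIt]; trivial
    obtain ⟨e, he⟩ := this
    exact ⟨e, fun n => by rw [he n, map_one]⟩
  obtain ⟨e, he⟩ := hI
  obtain ⟨l, hl⟩ : ∃ l : ℂ, e = algebraMap ℂ B l := by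
    apply Q.cen
    intro g
    apply Q.pts
    intro n
    obtain ⟨h, k, hkh, hh⟩ := P.cover (φ n)
    obtain ⟨D, hD⟩ := F.surjective (Q.ham g)
    have e1 : u k (h * h) = e * u k h ^ 2 + e * u k h ^ 2 := by
      apply ptsB
      intro m
      rw [map_add, map_mul, map_pow, hu, hu, Derivation.leibniz, hkh]
      have := he m
      simp only [smul_eq_mul, map_add, map_mul]
      linear_combination (- 2 * c m * φ m h ^ 2) * this
    have e2 : u k h * (F D).1 (u k (h * h)) =
        u k (h * h) * (F D).1 (u k h) + u k (h * h) * (F D).1 (u k h) := by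
      apply ptsB
      intro m
      rw [map_add, map_mul, map_mul, hu3, hu3, hu, hu, Derivation.leibniz, hkh]
      simp only [smul_eq_mul, map_add, map_mul, Derivation.leibniz]
      ring
    have hD' : F D = Q.ham g := hD
    rw [hD', ham_apply, ham_apply, e1] at e2
    have e3 := congrArg n e2
    simp only [pow_two, map_add, map_mul, Derivation.leibniz, smul_eq_mul] at e3
    have hne : n (u k h) ≠ 0 := by
      rw [hu, hkh]; exact mul_ne_zero (hc0 n) hh
    have e4 : n (u k h) ^ 3 * n (Q.br g e) = 0 := by linear_combination e3 / 2
    exact (mul_eq_zero.1 e4).resolve_left (pow_ne_zero _ hne)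
  have hcl : ∀ n, l * c n = 1 := by
    intro n
    have := he n
    rwa [hl, AlgHom.commutes] at this
  -- regularity
  have hR : ∀ h : A, ∃ v : B, ∀ n, n v = φ n h := by
    let R : Subalgebra ℂ A :=
      { carrier := {h | ∃ v : B, ∀ n, n v = φ n h}
        add_mem' := by
          rintro a b ⟨e, he⟩ ⟨e', he'⟩
          exact ⟨e + e', fun n => by rw [map_add, map_add, he, he']⟩
        mul_mem' := by
          rintro a b ⟨e, he⟩ ⟨e', he'⟩
          exact ⟨e * e', fun n => by rw [map_mul, map_mul, he, he']⟩
        algebraMap_mem' := by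
          intro r
          exact ⟨algebraMap ℂ B r, fun n => by rw [AlgHom.commutes, AlgHom.commutes]⟩ }
    have : Algebra.adjoin ℂ {t : A | ∃ f g, t = P.br f g} ≤ R := by
      rw [Algebra.adjoin_le_iff]
      rintro _ ⟨a, b, rfl⟩
      refine ⟨algebraMap ℂ B l * u a b, fun n => ?_⟩
      rw [map_mul, hu, AlgHom.commutes]
      simp only [Algebra.algebraMap_self, RingHom.id_apply]
      linear_combination (φ n (P.br a b)) * hcl n
    intro h
    have hh : h ∈ Algebra.adjoin ℂ {t : A | ∃ f g, t = P.br f g} := by rw [P.gen]; trivial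
    exact this hh
  choose ψ hψ using hR
  let Ψ : A →ₐ[ℂ] B :=
    { toFun := ψ
      map_one' := ptsB _ _ fun n => by rw [hψ, map_one, map_one]
      map_mul' := fun a b => ptsB _ _ fun n => by rw [map_mul, hψ, hψ, hψ, map_mul]
      map_zero' := ptsB _ _ fun n => by rw [hψ, map_zero, map_zero]
      map_add' := fun a b => ptsB _ _ fun n => by rw [map_add, hψ, hψ, hψ, map_add]
      commutes' := fun r => ptsB _ _ fun n => by rw [hψ, AlgHom.commutes, AlgHom.commutes] }
  have hΨ : ∀ n h, n (Ψ h) = φ n h := fun n h => hψ h n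
  refine ⟨Ψ, hΨ, fun D => ?_⟩
  let R : Subalgebra ℂ A :=
    { carrier := {h | (F D).1 (Ψ h) = Ψ (D.1 h)}
      add_mem' := by
        intro a b ha hb
        simp only [Set.mem_ofPred_eq] at *
        rw [map_add, map_add, map_add, map_add, ha, hb]
      mul_mem' := by
        intro a b ha hb
        simp only [Set.mem_ofPred_eq] at *
        rw [map_mul, Derivation.leibniz, Derivation.leibniz, ha, hb]
        simp
      algebraMap_mem' := by
        intro r
        simp }
  have : Algebra.adjoin ℂ {t : A | ∃ f g, t = P.br f g} ≤ R := by
    rw [Algebra.adjoin_le_iff]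
    rintro _ ⟨a, b, rfl⟩
    change (F D).1 (Ψ (P.br a b)) = Ψ (D.1 (P.br a b))
    have e1 : Ψ (P.br a b) = l • u a b := by
      apply ptsB
      intro n
      rw [hΨ, map_smul, hu, smul_eq_mul]
      linear_combination - (φ n (P.br a b)) * hcl n
    apply ptsB
    intro n
    rw [e1, Derivation.map_smul, map_smul, hu3, hΨ, smul_eq_mul]
    linear_combination (φ n (D.1 (P.br a b))) * hcl n
  intro h
  have hh : h ∈ Algebra.adjoin ℂ {t : A | ∃ f g, t = P.br f g} := by rw [P.gen]; trivial
  exact this hh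

theorem main (P : PoisD A V) (Q : PoisD B W) (F : V ≃ₗ⁅ℂ⁆ W) :
    ∃ ψ : A ≃ₐ[ℂ] B, ∀ (D : V) h, (F D).1 (ψ h) = ψ (D.1 h) := by
  choose φ hφ using exists_pt P Q F
  choose φ' hφ' using exists_pt Q P F.symm
  have i1 : ∀ n, φ' (φ n) = n := by
    intro n
    symm
    apply Q.iso_sep
    intro D hD
    apply hφ'
    apply hφ
    rwa [LieEquiv.apply_symm_apply]
  have i2 : ∀ n, φ (φ' n) = n := by
    intro n
    symm
    apply P.iso_sep
    intro D hD
    apply hφ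
    apply hφ'
    rwa [LieEquiv.symm_apply_apply]
  obtain ⟨ψ, h1, h2⟩ := half P Q F φ (by
    intro n D hD
    have := hφ' (φ n) (F D) (by rwa [LieEquiv.symm_apply_apply])
    rwa [i1] at this)
  obtain ⟨ψ', h1', -⟩ := half Q P F.symm φ' (by
    intro n D hD
    have := hφ (φ' n) (F.symm D) (by rwa [LieEquiv.apply_symm_apply])
    rwa [i2] at this)
  refine ⟨AlgEquiv.ofAlgHom ψ ψ' ?_ ?_, h2⟩
  · ext b
    rw [← sub_eq_zero]
    apply Q.pts
    intro n
    simp [h1, h1', i1]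
  · ext b
    rw [← sub_eq_zero]
    apply P.pts
    intro n
    simp [h1, h1', i2]

end three
end PoisD

section generic
variable {A : Type} [CommRing A] [Algebra ℂ A]

theorem gen_maxpt [Algebra.FiniteType ℂ A] (J : Ideal A) (hJ : J ≠ ⊤) :
    ∃ χ : A →ₐ[ℂ] ℂ, ∀ a ∈ J, χ a = 0 := by
  obtain ⟨m, hm, hJm⟩ := Ideal.exists_le_maximal J hJ
  let _ := Ideal.Quotient.field m
  have := finite_of_finite_type_of_isJacobsonRing ℂ (A ⧸ m)
  have hb := IsAlgClosed.algebraMap_bijective_of_isIntegral (k := ℂ) (K := A ⧸ m)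
  let e : ℂ ≃ₐ[ℂ] (A ⧸ m) := AlgEquiv.ofBijective (Algebra.ofId ℂ (A ⧸ m)) hb
  refine ⟨e.symm.toAlgHom.comp (Ideal.Quotient.mkₐ ℂ m), fun a ha => ?_⟩
  have : Ideal.Quotient.mk m a = 0 := Ideal.Quotient.eq_zero_iff_mem.2 (hJm ha)
  simp [this]

/-- The data of the generators and the bracket on the coordinate ring. -/
structure Dan (A : Type) [CommRing A] [Algebra ℂ A] (p : ℂ[X]) where
  x : A
  y : A
  z : A
  br : A →ₗ[ℂ] Derivation ℂ A A
  alt : ∀ f g, br f g = - br g f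
  hxy : x * y = aeval z p
  gen : Algebra.adjoin ℂ {x, y, z} = ⊤
  bzx : br z x = x
  bzy : br z y = - y
  bxy : br x y = - aeval z (derivative p)
  xreg : ∀ a, x * a = 0 → a = 0
  ptex : ∀ s t : ℂ, t ≠ 0 → ∃ χ : A →ₐ[ℂ] ℂ, χ x = t ∧ χ z = s

namespace Dan
variable {p : ℂ[X]} (S : Dan A p)

theorem der_zero (D : Derivation ℂ A A) (hx : D S.x = 0) (hy : D S.y = 0) (hz : D S.z = 0)
    (f : A) : D f = 0 := by
  have : D = 0 := by
    apply Derivation.ext_of_adjoin_eq_top _ S.gen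
    intro a ha
    simp only [Set.mem_insert_iff, Set.mem_singleton_iff] at ha
    rcases ha with rfl | rfl | rfl <;> simpa
  rw [this]; rfl

theorem bself (f : A) : S.br f f = 0 := by
  have h := S.alt f f
  have h2 : (2 : ℂ) • S.br f f = 0 := by rw [two_smul]; linear_combination h
  simpa using h2

theorem byx : S.br S.y S.x = aeval S.z (derivative p) := by rw [S.alt, S.bxy, neg_neg]
theorem bxz : S.br S.x S.z = - S.x := by rw [S.alt, S.bzx]
theorem byz : S.br S.y S.z = S.y := by rw [S.alt, S.bzy, neg_neg]

theorem bmul (f g h : A) : S.br (f * g) h = f * S.br g h + g * S.br f h := by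
  rw [S.alt (f * g) h, S.alt f h, S.alt g h, Derivation.leibniz]
  simp only [smul_eq_mul]; ring

theorem rel (D : Derivation ℂ A A) :
    D S.x * S.y + D S.y * S.x - D S.z * aeval S.z (derivative p) = 0 := by
  have h := congrArg D S.hxy
  rw [Derivation.leibniz, Derivation.map_aeval] at h
  simp only [smul_eq_mul] at h
  linear_combination h

theorem pl (D : Derivation ℂ A A) (f g k : A) :
    D f * S.br g k + D g * S.br k f + D k * S.br f g = 0 := by
  have step : ∀ g k, (∀ f ∈ ({S.x, S.y, S.z} : Set A),
      D f * S.br g k + D g * S.br k f + D k * S.br f g = 0) →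
      ∀ f, D f * S.br g k + D g * S.br k f + D k * S.br f g = 0 := by
    intro g k h f
    have e : ∀ f, (S.br g k • D + D g • S.br k - D k • S.br g) f =
        D f * S.br g k + D g * S.br k f + D k * S.br f g := by
      intro f
      rw [S.alt f g]
      simp only [Derivation.sub_apply, Derivation.add_apply, Derivation.smul_apply, smul_eq_mul]
      ring
    rw [← e]
    apply S.der_zero <;> rw [e] <;> apply h <;> simp
  have r := S.rel D
  apply step
  intro f hf
  have c1 : D g * S.br k f + D k * S.br f g + D f * S.br g k = 0 := by
    apply step
    intro g hg
    have c2 : D k * S.br f g + D f * S.br g k + D g * S.br k f = 0 := by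
      apply step
      intro k hk
      simp only [Set.mem_insert_iff, Set.mem_singleton_iff] at hf hg hk
      rcases hf with rfl | rfl | rfl <;> rcases hg with rfl | rfl | rfl <;>
        rcases hk with rfl | rfl | rfl <;>
        simp only [S.bself, S.bxy, S.byx, S.bxz, S.byz, S.bzx, S.bzy] <;>
        first
          | ring1
          | linear_combination r
          | linear_combination - r
    linear_combination c2
  linear_combination c1

theorem poi_of (D : Derivation ℂ A A)
    (hxy : D (S.br S.x S.y) = S.br (D S.x) S.y + S.br S.x (D S.y))
    (hyz : D (S.br S.y S.z) = S.br (D S.y) S.z + S.br S.y (D S.z))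
    (hzx : D (S.br S.z S.x) = S.br (D S.z) S.x + S.br S.z (D S.x)) (f g : A) :
    D (S.br f g) = S.br (D f) g + S.br f (D g) := by
  have sw : ∀ f g, D (S.br f g) = S.br (D f) g + S.br f (D g) →
      D (S.br g f) = S.br (D g) f + S.br g (D f) := by
    intro f g h
    rw [S.alt g f, S.alt (D g), S.alt g, map_neg, h]; ring
  have dg : ∀ f, D (S.br f f) = S.br (D f) f + S.br f (D f) := by
    intro f
    rw [S.bself, S.alt (D f)]; simp
  have step : ∀ f, (∀ g ∈ ({S.x, S.y, S.z} : Set A),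
      D (S.br f g) = S.br (D f) g + S.br f (D g)) → ∀ g,
      D (S.br f g) = S.br (D f) g + S.br f (D g) := by
    intro f h g
    have e : ∀ g, (⁅D, S.br f⁆ - S.br (D f)) g =
        D (S.br f g) - (S.br (D f) g + S.br f (D g)) := by
      intro g
      rw [Derivation.sub_apply, Derivation.commutator_apply]; ring
    rw [← sub_eq_zero, ← e]
    apply S.der_zero <;> rw [e, sub_eq_zero] <;> apply h <;> simp
  apply step
  intro g hg
  apply sw
  apply step
  intro f hf
  simp only [Set.mem_insert_iff, Set.mem_singleton_iff] at hf hg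
  rcases hf with rfl | rfl | rfl <;> rcases hg with rfl | rfl | rfl <;>
    first
      | exact dg _
      | assumption
      | (apply sw; assumption)

theorem uni (hp : IsCoprime p (derivative p)) :
    Ideal.span {t : A | ∃ f g, t = S.br f g} = ⊤ := by
  rw [Ideal.eq_top_iff_one]
  obtain ⟨u, v, h⟩ := hp
  have h1 := congrArg (aeval S.z) h
  simp only [map_add, map_mul, map_one] at h1
  rw [← h1, ← S.hxy]
  refine Ideal.add_mem _ ?_ ?_
  · rw [mul_comm S.x, ← mul_assoc]
    exact Ideal.mul_mem_left _ _ (Ideal.subset_span ⟨S.z, S.x, S.bzx.symm⟩)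
  · exact Ideal.mul_mem_left _ _ (Ideal.subset_span ⟨S.y, S.x, S.byx.symm⟩)

theorem gen_br (hp : IsCoprime p (derivative p)) :
    Algebra.adjoin ℂ {t : A | ∃ f g, t = S.br f g} = ⊤ := by
  set R := Algebra.adjoin ℂ {t : A | ∃ f g, t = S.br f g} with hR
  have hb : ∀ f g, S.br f g ∈ R := fun f g => Algebra.subset_adjoin ⟨f, g, rfl⟩
  have hx : S.x ∈ R := by rw [← S.bzx]; exact hb _ _
  have hy : S.y ∈ R := by rw [← S.byz]; exact hb _ _
  have hxw : ∀ w : ℂ[X], S.x * aeval S.z w ∈ R := by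
    intro w
    have : S.x * aeval S.z w = S.br S.z (S.x * aeval S.z w) := by
      rw [Derivation.leibniz, Derivation.map_aeval, S.bself, S.bzx]
      simp [mul_comm]
    rw [this]; exact hb _ _
  have h1 : ∀ w : ℂ[X], aeval S.z p * aeval S.z w ∈ R := by
    intro w
    rw [← S.hxy]
    have := R.mul_mem (hxw w) hy
    rwa [mul_assoc, mul_comm _ S.y, ← mul_assoc] at this
  have h2 : ∀ w : ℂ[X], aeval S.z (derivative p) * aeval S.z w ∈ R := by
    intro w
    have : aeval S.z (derivative p) * aeval S.z w =
        S.br S.y (S.x * aeval S.z w) - aeval S.z p * aeval S.z (derivative w) := by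
      rw [Derivation.leibniz, Derivation.map_aeval, S.byz, S.byx, ← S.hxy]
      simp only [smul_eq_mul]; ring
    rw [this]
    exact R.sub_mem (hb _ _) (h1 _)
  have hz : S.z ∈ R := by
    obtain ⟨u, v, h⟩ := hp
    have h3 := congrArg (aeval S.z) h
    simp only [map_add, map_mul, map_one] at h3
    have : S.z = aeval S.z p * aeval S.z (u * X) + aeval S.z (derivative p) * aeval S.z (v * X) := by
      simp only [map_mul, aeval_X]
      linear_combination (- S.z) * h3
    rw [this]
    exact R.add_mem (h1 _) (h2 _)
  rw [eq_top_iff, ← S.gen, Algebra.adjoin_le_iff]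
  rintro a (rfl | rfl | rfl) <;> assumption

theorem dp_ne (hp : IsCoprime p (derivative p)) {χ : A →ₐ[ℂ] ℂ} (hx : χ S.x = 0) :
    χ (aeval S.z (derivative p)) ≠ 0 := by
  intro h0
  obtain ⟨u, v, h⟩ := hp
  have h3 := congrArg (fun w => χ (aeval S.z w)) h
  simp only [map_add, map_mul, map_one, ← S.hxy, hx, h0] at h3
  simp at h3

theorem nd2 (hp : IsCoprime p (derivative p)) (χ : A →ₐ[ℂ] ℂ) :
    ∃ a b c d f, χ (S.br (S.br (S.br a b) (S.br c d)) f) ≠ 0 := by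
  by_cases hx : χ S.x = 0
  · by_cases hy : χ S.y = 0
    · have h1 := S.dp_ne hp hx
      refine ⟨S.z, S.x, S.z, S.y * S.y, S.x, ?_⟩
      rw [S.bzx, Derivation.leibniz, S.bzy]
      simp only [smul_eq_mul]
      have : χ (S.br (S.br S.x (S.y * -S.y + S.y * -S.y)) S.x) =
          4 * χ (aeval S.z (derivative p)) ^ 2 := by
        simp only [map_add, map_neg, mul_neg, Derivation.leibniz, Derivation.add_apply,
          Derivation.neg_apply, S.bxy, S.bmul, smul_eq_mul, S.byx, map_mul, hy]
        ring
      rw [this]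
      simpa using h1
    · refine ⟨S.z, S.y, S.z, S.y * S.z, S.z, ?_⟩
      simp only [Derivation.leibniz, S.bzy, S.bself, S.byz, smul_eq_mul, map_add, S.bmul, map_neg,
        map_mul, Derivation.add_apply, Derivation.neg_apply, neg_mul, mul_neg, mul_zero, zero_add]
      simp [hy]
  · refine ⟨S.z, S.x, S.z, S.x * S.z, S.z, ?_⟩
    simp only [Derivation.leibniz, S.bzx, S.bself, S.bxz, smul_eq_mul, map_add, S.bmul, map_neg,
      map_mul, Derivation.add_apply, Derivation.neg_apply]
    simp [hx]

/-- Evaluation of a polynomial in `x` with coefficients polynomials in `z`. -/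
def ev : ℂ[X][X] →+* A := Polynomial.eval₂RingHom (aeval S.z : ℂ[X] →ₐ[ℂ] A).toRingHom S.x

theorem ev_X : S.ev X = S.x := by simp [ev]
theorem ev_C (r : ℂ[X]) : S.ev (C r) = aeval S.z r := by simp [ev]

theorem loc (a : A) : ∃ (N : ℕ) (R : ℂ[X][X]), S.x ^ N * a = S.ev R := by
  have ha : a ∈ Algebra.adjoin ℂ ({S.x, S.y, S.z} : Set A) := by rw [S.gen]; trivial
  induction ha using Algebra.adjoin_induction with
  | mem a h =>
    simp only [Set.mem_insert_iff, Set.mem_singleton_iff] at h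
    rcases h with rfl | rfl | rfl
    · exact ⟨0, X, by simp [ev_X]⟩
    · exact ⟨1, C p, by rw [ev_C, pow_one, S.hxy]⟩
    · exact ⟨0, C X, by simp [ev_C]⟩
  | algebraMap r => exact ⟨0, C (C r), by simp [ev_C]⟩
  | add a b _ _ h1 h2 =>
    obtain ⟨N, R, hR⟩ := h1
    obtain ⟨M, T, hT⟩ := h2
    refine ⟨N + M, X ^ M * R + X ^ N * T, ?_⟩
    rw [map_add, map_mul, map_mul, map_pow, map_pow, ev_X, ← hR, ← hT]; ring
  | mul a b _ _ h1 h2 =>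
    obtain ⟨N, R, hR⟩ := h1
    obtain ⟨M, T, hT⟩ := h2
    refine ⟨N + M, R * T, ?_⟩
    rw [map_mul, ← hR, ← hT]; ring

theorem vanish (R : ℂ[X][X]) (h : ∀ χ : A →ₐ[ℂ] ℂ, χ (S.ev R) = 0) : R = 0 := by
  have h1 : ∀ s : ℂ, R.map (evalRingHom s) = 0 := by
    intro s
    apply Polynomial.eq_zero_of_infinite_isRoot
    apply Set.Infinite.mono (s := {t : ℂ | t ≠ 0})
    · intro t ht
      obtain ⟨χ, hx, hz⟩ := S.ptex s t ht
      have := h χ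
      rw [ev, coe_eval₂RingHom] at this
      have h2 := Polynomial.hom_eval₂ R (aeval S.z : ℂ[X] →ₐ[ℂ] A).toRingHom χ.toRingHom S.x
      simp only [AlgHom.toRingHom_eq_coe, RingHom.coe_coe] at h2 this
      rw [this, hx] at h2
      rw [Set.mem_ofPred_eq, IsRoot, eval_map, h2]
      congr 1
      ext
      · simp
      · simp [hz]
    · exact (Set.finite_singleton (0 : ℂ)).infinite_compl
  ext1 n
  rw [coeff_zero]
  apply Polynomial.funext
  intro s
  have := congrArg (fun w => coeff w n) (h1 s)
  simpa using this

theorem ev_inj (R : ℂ[X][X]) (h : S.ev R = 0) : R = 0 :=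
  S.vanish R (fun χ => by rw [h, map_zero])

theorem xpow_reg (N : ℕ) (a : A) (h : S.x ^ N * a = 0) : a = 0 := by
  induction N with
  | zero => simpa using h
  | succ n ih =>
    apply ih
    apply S.xreg
    rw [← h]; ring

theorem pts {p : ℂ[X]} (S : Dan A p) (a : A) (h : ∀ χ : A →ₐ[ℂ] ℂ, χ a = 0) : a = 0 := by
  obtain ⟨N, R, hR⟩ := S.loc a
  apply S.xpow_reg N
  rw [hR, S.vanish R, map_zero]
  intro χ
  rw [← hR, map_mul, h, mul_zero]

theorem bz_ev (R : ℂ[X][X]) : S.br S.z (S.ev R) = S.ev (X * derivative R) := by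
  induction R using Polynomial.induction_on' with
  | add P Q h1 h2 => simp only [map_add, mul_add, h1, h2]
  | monomial n r =>
    rw [← C_mul_X_pow_eq_monomial, map_mul, map_pow, ev_C, ev_X, Derivation.leibniz,
      Derivation.leibniz_pow, Derivation.map_aeval, S.bself, S.bzx, derivative_C_mul_X_pow]
    rcases n with _ | n
    · simp
    · simp only [map_mul, map_pow, ev_C, ev_X, smul_eq_mul, nsmul_eq_mul]
      simp
      ring

theorem cen {p : ℂ[X]} (S : Dan A p) (e : A) (h : ∀ g, S.br g e = 0) : ∃ l : ℂ, e = algebraMap ℂ A l := by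
  obtain ⟨N, R, hR⟩ := S.loc e
  have h1 := S.bz_ev R
  rw [← hR, Derivation.leibniz, h, Derivation.leibniz_pow, S.bzx] at h1
  have h2 : X * derivative R - (N : ℂ[X][X]) * R = 0 := by
    apply S.ev_inj
    rw [map_sub, ← h1, map_mul, ← hR, map_natCast]
    rcases N with _ | n
    · simp
    · simp only [smul_eq_mul, nsmul_eq_mul]
      simp
      ring
  have h3 : R = C (R.coeff N) * X ^ N := by
    ext1 n
    rw [coeff_C_mul_X_pow]
    split_ifs with hn
    · rw [hn]
    · have h4 := congrArg (fun w => coeff w n) h2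
      simp only [coeff_sub, coeff_zero, coeff_natCast_mul] at h4
      have h5 : (X * derivative R).coeff n = R.coeff n * n := by
        rcases n with _ | n
        · simp
        · rw [coeff_X_mul, coeff_derivative]; simp
      rw [h5] at h4
      have h6 : ((n : ℂ[X]) - N) * R.coeff n = 0 := by linear_combination h4
      rcases mul_eq_zero.1 h6 with h7 | h7
      · exact absurd (Nat.cast_injective (sub_eq_zero.1 h7)) hn
      · exact h7
  set r := R.coeff N
  have h4 : e = aeval S.z r := by
    rw [← sub_eq_zero]
    apply S.xpow_reg N
    rw [mul_sub, hR, h3, map_mul, map_pow, ev_C, ev_X]; ring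
  have h5 := h S.x
  rw [h4, Derivation.map_aeval, S.bxz, smul_eq_mul] at h5
  have h6 : aeval S.z (derivative r) = 0 := by
    apply S.xreg; linear_combination - h5
  rw [← S.ev_C] at h6
  have h7 := C_eq_zero.1 (S.ev_inj _ h6)
  refine ⟨r.coeff 0, ?_⟩
  rw [h4]
  have h8 := eq_C_of_derivative_eq_zero h7
  rw [h8]; simp

theorem cover (hp : IsCoprime p (derivative p)) (χ : A →ₐ[ℂ] ℂ) :
    ∃ h k, S.br k h = h ∧ χ h ≠ 0 := by
  by_cases hx : χ S.x = 0
  swap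
  · exact ⟨S.x, S.z, S.bzx, hx⟩
  by_cases hy : χ S.y = 0
  swap
  · exact ⟨S.y, - S.z, by simp [S.bzy], hy⟩
  obtain ⟨s, hs⟩ := Polynomial.binomExpansion (p.map (algebraMap ℂ A)) S.z S.x
  rw [derivative_map, eval_map_algebraMap, eval_map_algebraMap, eval_map_algebraMap] at hs
  set h := S.y + aeval S.z (derivative p) + s * S.x with hh
  have h1 : S.x * h = aeval (S.z + S.x) p := by
    rw [hs, hh, ← S.hxy]; ring
  refine ⟨h, - (S.z + S.x), ?_, ?_⟩
  · have h2 := congrArg (S.br (S.z + S.x)) h1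
    rw [Derivation.map_aeval, S.bself, smul_zero, Derivation.leibniz, smul_eq_mul, smul_eq_mul] at h2
    have h3 : S.br (S.z + S.x) S.x = S.x := by
      rw [map_add, Derivation.add_apply, S.bzx, S.bself, add_zero]
    rw [h3] at h2
    have h4 : S.br (S.z + S.x) h + h = 0 := by
      apply S.xreg; linear_combination h2
    rw [map_neg, Derivation.neg_apply]
    linear_combination - h4
  · rw [hh, map_add, map_add, map_mul, hx, hy]
    simpa using S.dp_ne hp hx

end Dan
end generic

section concrete
open MvPolynomial (pderiv)

/-- The polynomial `p'(z)` in three variables. -/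
def p1P (p : ℂ[X]) : P3 := Polynomial.aeval zP (derivative p)

theorem pd00 : pderiv (0 : Fin 3) xP = 1 := by simp [xP]
theorem pd01 : pderiv (0 : Fin 3) yP = 0 := by simp [yP, MvPolynomial.pderiv_X]
theorem pd02 : pderiv (0 : Fin 3) zP = 0 := by simp [zP, MvPolynomial.pderiv_X]
theorem pd10 : pderiv (1 : Fin 3) xP = 0 := by simp [xP, MvPolynomial.pderiv_X]
theorem pd11 : pderiv (1 : Fin 3) yP = 1 := by simp [yP]
theorem pd12 : pderiv (1 : Fin 3) zP = 0 := by simp [zP, MvPolynomial.pderiv_X]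
theorem pd20 : pderiv (2 : Fin 3) xP = 0 := by simp [xP, MvPolynomial.pderiv_X]
theorem pd21 : pderiv (2 : Fin 3) yP = 0 := by simp [yP, MvPolynomial.pderiv_X]
theorem pd22 : pderiv (2 : Fin 3) zP = 1 := by simp [zP]
theorem pd0a (w : ℂ[X]) : pderiv (0 : Fin 3) (Polynomial.aeval zP w) = 0 := by
  rw [Derivation.map_aeval, pd02, smul_zero]
theorem pd1a (w : ℂ[X]) : pderiv (1 : Fin 3) (Polynomial.aeval zP w) = 0 := by
  rw [Derivation.map_aeval, pd12, smul_zero]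
theorem pd0p (p : ℂ[X]) : pderiv (0 : Fin 3) (p1P p) = 0 := pd0a _
theorem pd1p (p : ℂ[X]) : pderiv (1 : Fin 3) (p1P p) = 0 := pd1a _

theorem pd_comm (i j : Fin 3) (f : P3) : pderiv i (pderiv j f) = pderiv j (pderiv i f) := by
  have h : ⁅(pderiv i : Derivation ℂ P3 P3), (pderiv j : Derivation ℂ P3 P3)⁆ = 0 := by
    apply MvPolynomial.derivation_ext
    intro k
    rw [Derivation.commutator_apply, MvPolynomial.pderiv_X, MvPolynomial.pderiv_X]
    simp only [Pi.single_apply]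
    split_ifs <;> simp
  have h2 := congrArg (fun D => D f) h
  simp only [Derivation.commutator_apply, Derivation.zero_apply] at h2
  exact sub_eq_zero.1 h2

theorem der_formula (D : Derivation ℂ P3 P3) (f : P3) :
    D f = D xP * pderiv 0 f + D yP * pderiv 1 f + D zP * pderiv 2 f := by
  have h : D = D xP • pderiv 0 + D yP • pderiv 1 + D zP • pderiv 2 := by
    apply MvPolynomial.derivation_ext
    intro k
    simp only [Derivation.add_apply, Derivation.smul_apply, smul_eq_mul]
    fin_cases k
    · change D xP = D xP * pderiv 0 xP + D yP * pderiv 1 xP + D zP * pderiv 2 xP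
      rw [pd00, pd10, pd20]; ring
    · change D yP = D xP * pderiv 0 yP + D yP * pderiv 1 yP + D zP * pderiv 2 yP
      rw [pd01, pd11, pd21]; ring
    · change D zP = D xP * pderiv 0 zP + D yP * pderiv 1 zP + D zP * pderiv 2 zP
      rw [pd02, pd12, pd22]; ring
  conv_lhs => rw [h]
  simp

/-- The bracket upstairs. -/
def J (p : ℂ[X]) (f : P3) : Derivation ℂ P3 P3 :=
  (xP * pderiv 2 f + p1P p * pderiv 1 f) • pderiv 0
    + (- p1P p * pderiv 0 f - yP * pderiv 2 f) • pderiv 1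
    + (yP * pderiv 1 f - xP * pderiv 0 f) • pderiv 2

theorem J_apply (p : ℂ[X]) (f g : P3) : J p f g =
    (xP * pderiv 2 f + p1P p * pderiv 1 f) * pderiv 0 g
    + (- p1P p * pderiv 0 f - yP * pderiv 2 f) * pderiv 1 g
    + (yP * pderiv 1 f - xP * pderiv 0 f) * pderiv 2 g := rfl

theorem J_alt (p : ℂ[X]) (f g : P3) : J p f g = - J p g f := by
  rw [J_apply, J_apply]; ring

theorem J_rel (p : ℂ[X]) (f : P3) : J p f (xP * yP - Polynomial.aeval zP p) = 0 := by
  have h : pderiv 2 (Polynomial.aeval zP p) = p1P p := by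
    rw [Derivation.map_aeval, pd22, smul_eq_mul, mul_one]; rfl
  rw [J_apply]
  simp only [map_sub, Derivation.leibniz, smul_eq_mul, pd0a, pd1a, h, pd00, pd01, pd10, pd11, pd20,
    pd21]
  ring

theorem J_x (p : ℂ[X]) (f : P3) : J p f xP = xP * pderiv 2 f + p1P p * pderiv 1 f := by
  rw [J_apply, pd00, pd10, pd20]; ring
theorem J_y (p : ℂ[X]) (f : P3) : J p f yP = - p1P p * pderiv 0 f - yP * pderiv 2 f := by
  rw [J_apply, pd01, pd11, pd21]; ring
theorem J_z (p : ℂ[X]) (f : P3) : J p f zP = yP * pderiv 1 f - xP * pderiv 0 f := by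
  rw [J_apply, pd02, pd12, pd22]; ring

theorem J_div (p : ℂ[X]) (f : P3) : pderiv (0 : Fin 3) (J p f xP) + pderiv (1 : Fin 3) (J p f yP) +
      pderiv (2 : Fin 3) (J p f zP) = 0 := by
  rw [J_x, J_y, J_z]
  simp only [map_sub, map_add, map_neg, neg_mul, Derivation.leibniz, smul_eq_mul, pd0p, pd1p, pd00,
    pd01, pd10, pd11, pd20, pd21]
  rw [pd_comm 1 0, pd_comm 2 0, pd_comm 2 1]
  ring

theorem rel_mem (p : ℂ[X]) (D : Derivation ℂ P3 P3)
    (hD : D (xP * yP - Polynomial.aeval zP p) = 0) (f : P3) (hf : f ∈ relIdeal p) :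
    D f ∈ relIdeal p := by
  obtain ⟨c, rfl⟩ := Ideal.mem_span_singleton'.1 hf
  rw [Derivation.leibniz, hD, smul_zero, zero_add, smul_eq_mul]
  exact Ideal.mul_mem_right _ _ (Ideal.subset_span rfl)

theorem J_mem_right (p : ℂ[X]) (f g : P3) (hg : g ∈ relIdeal p) : J p f g ∈ relIdeal p :=
  rel_mem p _ (J_rel p f) g hg

theorem J_mem_left (p : ℂ[X]) (f g : P3) (hf : f ∈ relIdeal p) : J p f g ∈ relIdeal p := by
  rw [J_alt]; exact neg_mem (J_mem_right p g f hf)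

/-- The quotient map. -/
abbrev mkq (p : ℂ[X]) : P3 →ₐ[ℂ] ODan p := Ideal.Quotient.mkₐ ℂ (relIdeal p)

theorem mkq_surj (p : ℂ[X]) : Function.Surjective (mkq p) := Ideal.Quotient.mkₐ_surjective ℂ _

theorem mkq_zero (p : ℂ[X]) (f : P3) : mkq p f = 0 ↔ f ∈ relIdeal p :=
  Ideal.Quotient.eq_zero_iff_mem

/-- The bracket with a polynomial, on the quotient. -/
def brq (p : ℂ[X]) (f : P3) : Derivation ℂ (ODan p) (ODan p) :=
  Derivation.liftOfSurjective (f := mkq p) (mkq_surj p) (d := J p f)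
    (fun g hg => (mkq_zero p _).2 (J_mem_right p f g ((mkq_zero p _).1 hg)))

theorem brq_apply (p : ℂ[X]) (f g : P3) : brq p f (mkq p g) = mkq p (J p f g) :=
  Derivation.liftOfSurjective_apply (f := mkq p) (mkq_surj p) (d := J p f)
    (fun g hg => (mkq_zero p _).2 (J_mem_right p f g ((mkq_zero p _).1 hg))) g

theorem brq_ext (p : ℂ[X]) {D E : Derivation ℂ (ODan p) (ODan p)}
    (h : ∀ g, D (mkq p g) = E (mkq p g)) : D = E := by
  ext a
  obtain ⟨g, rfl⟩ := mkq_surj p a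
  exact h g

/-- The bracket as a linear map from the polynomial ring. -/
def brl (p : ℂ[X]) : P3 →ₗ[ℂ] Derivation ℂ (ODan p) (ODan p) where
  toFun := brq p
  map_add' f g := by
    apply brq_ext
    intro k
    rw [Derivation.add_apply, brq_apply, brq_apply, brq_apply, ← map_add, J_alt, map_add,
      J_alt p f, J_alt p g]
    congr 1; ring
  map_smul' c f := by
    apply brq_ext
    intro k
    rw [RingHom.id_apply, Derivation.smul_apply, brq_apply, brq_apply, ← map_smul, J_alt, Derivation.map_smul,
      J_alt p f, smul_neg]

theorem brl_congr (p : ℂ[X]) {f g : P3} (h : mkq p f = mkq p g) : brl p f = brl p g := by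
  rw [← sub_eq_zero, ← map_sub, mkq_zero] at h
  have h1 : brl p f = brl p (f - g) + brl p g := by rw [← map_add, sub_add_cancel]
  apply brq_ext
  intro k
  rw [h1, Derivation.add_apply, add_eq_right]
  change brq p (f - g) (mkq p k) = _
  rw [brq_apply, mkq_zero]
  exact J_mem_left p _ k h

/-- The bracket. -/
def brO (p : ℂ[X]) : ODan p →ₗ[ℂ] Derivation ℂ (ODan p) (ODan p) where
  toFun a := brl p (Function.surjInv (mkq_surj p) a)
  map_add' a b := by
    rw [← map_add]
    apply brl_congr
    simp only [map_add, Function.surjInv_eq]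
  map_smul' c a := by
    rw [RingHom.id_apply, ← map_smul]
    apply brl_congr
    simp only [map_smul, Function.surjInv_eq]

theorem brO_mk (p : ℂ[X]) (f : P3) : brO p (mkq p f) = brq p f :=
  brl_congr p (Function.surjInv_eq (mkq_surj p) _)

theorem brO_apply (p : ℂ[X]) (f g : P3) : brO p (mkq p f) (mkq p g) = mkq p (J p f g) := by
  rw [brO_mk, brq_apply]

theorem zreg_aux (S : P3) : ∃ T, S = (MvPolynomial.aeval ![0, yP, zP] : P3 →ₐ[ℂ] P3) S + xP * T := by
  induction S using MvPolynomial.induction_on with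
  | C a => exact ⟨0, by simp⟩
  | add f g hf hg =>
    obtain ⟨T, hT⟩ := hf
    obtain ⟨U, hU⟩ := hg
    refine ⟨T + U, ?_⟩
    rw [map_add]
    linear_combination hT + hU
  | mul_X f i hf =>
    obtain ⟨T, hT⟩ := hf
    rw [map_mul, MvPolynomial.aeval_X]
    fin_cases i
    · refine ⟨f, ?_⟩
      change f * xP = _ * 0 + _
      ring
    · refine ⟨T * yP, ?_⟩
      change f * yP = _ * yP + _
      linear_combination yP * hT
    · refine ⟨T * zP, ?_⟩
      change f * zP = _ * zP + _
      linear_combination zP * hT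

theorem xreg_aux (p : ℂ[X]) (hp : p ≠ 0) (a : ODan p) (h : mkq p xP * a = 0) : a = 0 := by
  obtain ⟨f, rfl⟩ := mkq_surj p a
  rw [← map_mul, mkq_zero] at h
  obtain ⟨S, hS⟩ := Ideal.mem_span_singleton'.1 h
  have hx : (MvPolynomial.aeval ![0, yP, zP] : P3 →ₐ[ℂ] P3) xP = 0 := by
    rw [xP, MvPolynomial.aeval_X]; rfl
  have hz : (MvPolynomial.aeval ![0, yP, zP] : P3 →ₐ[ℂ] P3) zP = zP := by
    conv_lhs => rw [zP, MvPolynomial.aeval_X]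
    rfl
  have hne : Polynomial.aeval zP p ≠ 0 := by
    intro h0
    apply hp
    apply Polynomial.funext
    intro s
    have := congrArg (MvPolynomial.aeval (R := ℂ) (fun _ : Fin 3 => s)) h0
    rw [← Polynomial.aeval_algHom_apply, zP, MvPolynomial.aeval_X] at this
    simpa [Polynomial.aeval_def] using this
  have h1 := congrArg (MvPolynomial.aeval ![0, yP, zP] : P3 →ₐ[ℂ] P3) hS
  rw [map_mul, map_mul, map_sub, map_mul, hx, zero_mul, zero_mul, zero_sub,
    ← Polynomial.aeval_algHom_apply, hz] at h1
  have h2 : (MvPolynomial.aeval ![0, yP, zP] : P3 →ₐ[ℂ] P3) S = 0 := by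
    rcases mul_eq_zero.1 h1 with h2 | h2
    · exact h2
    · exact absurd (neg_eq_zero.1 h2) hne
  obtain ⟨T, hT⟩ := zreg_aux S
  rw [h2, zero_add] at hT
  rw [mkq_zero]
  refine Ideal.mem_span_singleton'.2 ⟨T, ?_⟩
  have hx0 : xP ≠ 0 := MvPolynomial.X_ne_zero _
  apply mul_left_cancel₀ hx0
  rw [← hS, hT]; ring

theorem gen_aux (p : ℂ[X]) : Algebra.adjoin ℂ {mkq p xP, mkq p yP, mkq p zP} = ⊤ := by
  rw [eq_top_iff]
  intro a _
  obtain ⟨f, rfl⟩ := mkq_surj p a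
  induction f using MvPolynomial.induction_on with
  | C a => 
    have : mkq p (MvPolynomial.C a) = algebraMap ℂ _ a := (mkq p).commutes a
    rw [this]; exact Subalgebra.algebraMap_mem _ _
  | add f g hf hg => 
    rw [map_add]; exact add_mem (hf trivial) (hg trivial)
  | mul_X f i hf =>
    rw [map_mul]
    refine mul_mem (hf trivial) (Algebra.subset_adjoin ?_)
    fin_cases i
    · exact Or.inl rfl
    · exact Or.inr (Or.inl rfl)
    · exact Or.inr (Or.inr rfl)

theorem ptex_aux (p : ℂ[X]) (s t : ℂ) (ht : t ≠ 0) :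
    ∃ χ : ODan p →ₐ[ℂ] ℂ, χ (mkq p xP) = t ∧ χ (mkq p zP) = s := by
  let e : P3 →ₐ[ℂ] ℂ := MvPolynomial.aeval ![t, p.eval s / t, s]
  have hx : e xP = t := by simp [e, xP]
  have hy : e yP = p.eval s / t := by simp [e, yP]
  have hz : e zP = s := by simp [e, zP]
  refine ⟨Ideal.Quotient.liftₐ (relIdeal p) e ?_, ?_, ?_⟩
  · intro f hf
    obtain ⟨c, rfl⟩ := Ideal.mem_span_singleton'.1 hf
    rw [map_mul, map_sub, map_mul, ← Polynomial.aeval_algHom_apply, hx, hy, hz,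
      Polynomial.coe_aeval_eq_eval]
    field_simp
    simp
  · exact hx
  · exact hz

/-- The generators and bracket on the coordinate ring of the Danielewski surface. -/
def danO (p : ℂ[X]) (hp : p ≠ 0) : Dan (ODan p) p where
  x := mkq p xP
  y := mkq p yP
  z := mkq p zP
  br := brO p
  alt f g := by
    obtain ⟨f, rfl⟩ := mkq_surj p f
    obtain ⟨g, rfl⟩ := mkq_surj p g
    rw [brO_apply, brO_apply, J_alt, map_neg]
  hxy := by
    rw [← map_mul, Polynomial.aeval_algHom_apply, ← sub_eq_zero, ← map_sub, mkq_zero]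
    exact Ideal.subset_span rfl
  gen := gen_aux p
  bzx := by
    rw [brO_apply, J_x, pd22, pd12]; congr 1; ring
  bzy := by
    rw [brO_apply, J_y, pd22, pd02, ← map_neg]; congr 1; ring
  bxy := by
    rw [brO_apply, J_y, pd00, pd20, Polynomial.aeval_algHom_apply, ← map_neg]
    congr 1; rw [p1P]; ring
  xreg := xreg_aux p hp
  ptex := ptex_aux p

theorem brO_mem (p : ℂ[X]) (f : ODan p) : brO p f ∈ VeZero p := by
  obtain ⟨f, rfl⟩ := mkq_surj p f
  refine ⟨J p f, J_rel p f, fun g => brO_apply p f g, ?_⟩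
  rw [J_div]; exact zero_mem _

theorem poiO (p : ℂ[X]) (hp : p ≠ 0) (D : Derivation ℂ (ODan p) (ODan p)) (hD : D ∈ VeZero p)
    (f g : ODan p) : D (brO p f g) = brO p (D f) g + brO p f (D g) := by
  obtain ⟨δ, h0, hl, hdiv⟩ := hD
  replace hl : ∀ f, D (mkq p f) = mkq p (δ f) := hl
  set v := pderiv (0 : Fin 3) (δ xP) + pderiv (1 : Fin 3) (δ yP) +
      pderiv (2 : Fin 3) (δ zP) with hv
  have h0' : δ xP * yP + δ yP * xP - δ zP * p1P p = 0 := by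
    rw [map_sub, Derivation.leibniz, Derivation.map_aeval] at h0
    simp only [smul_eq_mul] at h0
    rw [p1P]; linear_combination h0
  have k0 := congrArg (pderiv (0 : Fin 3)) h0'
  have k1 := congrArg (pderiv (1 : Fin 3)) h0'
  have k2 := congrArg (pderiv (2 : Fin 3)) h0'
  simp only [map_sub, map_add, Derivation.leibniz, smul_eq_mul, pd00, pd01, pd10, pd11, pd20,
    pd21, pd0p, pd1p, map_zero] at k0 k1 k2
  have hp1 : δ (p1P p) = δ zP * pderiv 2 (p1P p) := by
    rw [der_formula δ (p1P p), pd0p, pd1p]; ring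
  have main : ∀ f g : P3, δ (J p f g) - J p (δ f) g - J p f (δ g) + v * J p f g = 0 →
      D (brO p (mkq p f) (mkq p g)) =
        brO p (D (mkq p f)) (mkq p g) + brO p (mkq p f) (D (mkq p g)) := by
    intro f g h
    rw [hl, hl, brO_apply, hl, brO_apply, brO_apply, ← map_add, ← sub_eq_zero, ← map_sub, mkq_zero]
    have : δ (J p f g) - (J p (δ f) g + J p f (δ g)) = - J p f g * v := by
      linear_combination h
    rw [this]
    exact Ideal.mul_mem_left _ _ hdiv
  apply (danO p hp).poi_of D
  · apply main xP yP
    rw [J_alt p xP (δ yP)]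
    simp only [J_x, J_y, pd00, pd20, map_neg, map_sub, map_mul, Derivation.leibniz, smul_eq_mul,
      mul_one, mul_zero, sub_zero, hp1]
    rw [hv]
    linear_combination k2
  · apply main yP zP
    rw [J_alt p yP (δ zP)]
    simp only [J_z, J_y, pd11, pd01, map_neg, map_sub, map_mul, Derivation.leibniz, smul_eq_mul,
      mul_one, mul_zero, sub_zero]
    rw [hv]
    linear_combination k0
  · apply main zP xP
    rw [J_alt p zP (δ xP)]
    simp only [J_x, J_z, pd22, pd12, map_neg, map_add, map_mul, Derivation.leibniz, smul_eq_mul,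
      mul_one, mul_zero, add_zero]
    rw [hv]
    linear_combination k1

end concrete

theorem coprime_of_sqf {p : ℂ[X]} (h : Squarefree p) : IsCoprime p (derivative p) :=
  PerfectField.separable_iff_squarefree.2 h

/-- The abstract structure on the coordinate ring of the Danielewski surface. -/
def poisO (p : ℂ[X]) (h : Squarefree p)
    (V : LieSubalgebra ℂ (Derivation ℂ (ODan p) (ODan p))) (hV : (V : Set _) = VeZero p) :
    PoisD (ODan p) V where
  br := brO p
  alt := (danO p h.ne_zero).alt
  mem f := by
    change brO p f ∈ (V : Set _)
    rw [hV]; exact brO_mem p f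
  poi D hD f g := poiO p h.ne_zero D (by rw [← hV]; exact hD) f g
  pl := (danO p h.ne_zero).pl
  uni := (danO p h.ne_zero).uni (coprime_of_sqf h)
  nd2 := (danO p h.ne_zero).nd2 (coprime_of_sqf h)
  pts := (danO p h.ne_zero).pts
  maxpt J hJ := gen_maxpt J hJ
  cen := (danO p h.ne_zero).cen
  cover := (danO p h.ne_zero).cover (coprime_of_sqf h)
  gen := (danO p h.ne_zero).gen_br (coprime_of_sqf h)

/-- Let `p, q` be squarefree with `2 ≤ deg p ≤ deg q` and `3 ≤ deg q`.  Any isomorphism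
of Lie algebras `F : Ve⁰(D_p) → Ve⁰(D_q)` is induced by a `ℂ`-algebra isomorphism
`φ* : O(D_q) → O(D_p)`, i.e. `F(δ) = (φ*)⁻¹ ∘ δ ∘ φ*` for all `δ ∈ Ve⁰(D_p)`. -/
theorem veZero_equiv_induced (p q : ℂ[X])
    (hsp : Squarefree p) (hsq : Squarefree q)
    (hp2 : 2 ≤ p.natDegree) (hpq : p.natDegree ≤ q.natDegree) (hq3 : 3 ≤ q.natDegree)
    (Vp : LieSubalgebra ℂ (Derivation ℂ (ODan p) (ODan p))) (hVp : (Vp : Set _) = VeZero p)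
    (Vq : LieSubalgebra ℂ (Derivation ℂ (ODan q) (ODan q))) (hVq : (Vq : Set _) = VeZero q)
    (F : Vp ≃ₗ⁅ℂ⁆ Vq) :
    ∃ φ : ODan q ≃ₐ[ℂ] ODan p, ∀ d : Vp, ∀ g : ODan q,
      ((F d : Vq) : Derivation ℂ (ODan q) (ODan q)) g =
        φ.symm (((d : Vp) : Derivation ℂ (ODan p) (ODan p)) (φ g)) := by
  obtain ⟨ψ, hψ⟩ := PoisD.main (poisO p hsp Vp hVp) (poisO q hsq Vq hVq) F
  refine ⟨ψ.symm, fun d g => ?_⟩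
  have h := hψ d (ψ.symm g)
  rw [AlgEquiv.apply_symm_apply] at h
  rw [h, AlgEquiv.symm_symm]

end
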